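/- Let X be a geodesic δ-hyperbolic metric space, let G be a group that is not virtually cyclic acting on X by isometries with a unital axial WPD loxodromic element f ∈ G, let x₀ ∈ Ax(f), and let S be a finite generating set of G. Then there exists D₀ > 0 such that for each ε > 0, each D ≥ D₀ and all E, E' ≥ 0 there exists a constant N = N(ε,D,E,E') such that for every finite set A ⊆ G there exists A' ⊆ A satisfying: (1) #A' ≥ (1−ε)·#A; and (2) for each a ∈ A' there exist u₁, u₂ ∈ G such that #(A \ a·((𝓗_{D,E,f}(u₁) ∪ 𝓗_{D,E,f}(u₂)) \ {g ∈ G : ‖g‖_S ≤ E'})) ≤ N. -/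

import Mathlib

noncomputable section

open Set Metric Pointwise

/-- The Gromov product `(y|z)_x`. -/
def gromovProd {X : Type*} [MetricSpace X] (x y z : X) : ℝ :=
  (dist x y + dist x z - dist y z) / 2

/-- `γ` restricted to `[a, b]` is a unit-speed geodesic. -/
def IsGeodesicParam {X : Type*} [MetricSpace X] (γ : ℝ → X) (a b : ℝ) : Prop :=
  ∀ s ∈ Set.Icc a b, ∀ t ∈ Set.Icc a b, dist (γ s) (γ t) = |s - t|

/-- `γ` is a geodesic from `x` to `y`, parametrized by arclength on `[0, dist x y]`. -/
def IsGeodesicBetween {X : Type*} [MetricSpace X] (γ : ℝ → X) (x y : X) : Prop :=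
  γ 0 = x ∧ γ (dist x y) = y ∧ IsGeodesicParam γ 0 (dist x y)

/-- A geodesic metric space: any two points are joined by a geodesic. -/
def GeodesicSpace (X : Type*) [MetricSpace X] : Prop :=
  ∀ x y : X, ∃ γ : ℝ → X, IsGeodesicBetween γ x y

/-- A geodesic space in which every geodesic triangle is `δ`-thin. -/
def GromovHyperbolic (X : Type*) [MetricSpace X] (δ : ℝ) : Prop :=
  GeodesicSpace X ∧
    ∀ (x y z : X) (γ₁ γ₂ γ₃ : ℝ → X),
      IsGeodesicBetween γ₁ x z → IsGeodesicBetween γ₂ x y → IsGeodesicBetween γ₃ y z →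
        ∀ t ∈ Set.Icc (0 : ℝ) (dist x z),
          ∃ u ∈ γ₂ '' Set.Icc (0 : ℝ) (dist x y) ∪ γ₃ '' Set.Icc (0 : ℝ) (dist y z),
            dist (γ₁ t) u ≤ δ

/-- A subset of `X` which is the image of a geodesic segment. -/
def IsGeodesicSegSet {X : Type*} [MetricSpace X] (A : Set X) : Prop :=
  ∃ (γ : ℝ → X) (a b : ℝ), a ≤ b ∧ IsGeodesicParam γ a b ∧ A = γ '' Set.Icc a b

/-- The set of nearest-point projections of `x` to `A`. -/
def nearestPts {X : Type*} [MetricSpace X] (A : Set X) (x : X) : Set X :=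
  {a ∈ A | dist x a = Metric.infDist x A}

/-- The nearest-point projection of the set `B` to `A`. -/
def projSet {X : Type*} [MetricSpace X] (A B : Set X) : Set X := ⋃ x ∈ B, nearestPts A x

/-- `diam_A(B)`, the diameter of the projection of `B` to `A`. -/
def projDiam {X : Type*} [MetricSpace X] (A B : Set X) : ℝ := Metric.diam (projSet A B)

/-- `d_A(B, C) = diam (π_A (B ∪ C))`. -/
def projDist {X : Type*} [MetricSpace X] (A B C : Set X) : ℝ := Metric.diam (projSet A (B ∪ C))

/-- The halfspace `H_half(x, y)` of points at least as close to `x` as to `y`. -/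
def halfspace {X : Type*} [MetricSpace X] (x y : X) : Set X := {z | dist z x ≤ dist z y}

/-- A group is virtually cyclic if it has a cyclic subgroup of finite index. -/
def VirtuallyCyclic (G : Type*) [Group G] : Prop :=
  ∃ H : Subgroup G, H.FiniteIndex ∧ IsCyclic H

/-- The WPD property for `f` relative to the basepoint `x₀`. -/
def WPD {G : Type*} [Group G] {X : Type*} [MetricSpace X] [MulAction G X]
    (f : G) (x₀ : X) : Prop :=
  ∀ R : ℝ, 0 < R → ∃ L : ℕ, 0 < L ∧
    {g : G | dist x₀ (g • x₀) < R ∧ dist ((f ^ L) • x₀) ((g * f ^ L) • x₀) < R}.Finite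

/-- The word norm with respect to the generating set `S`. -/
def wordNorm {G : Type*} [Group G] (S : Finset G) (g : G) : ℕ :=
  sInf {n : ℕ | ∃ l : List G, l.length = n ∧ (∀ x ∈ l, x ∈ S ∨ x⁻¹ ∈ S) ∧ l.prod = g}

/-- The word metric with respect to the generating set `S`. -/
def wordDist {G : Type*} [Group G] (S : Finset G) (g h : G) : ℕ := wordNorm S (g⁻¹ * h)

/-- `B` is an `r`-roughly branching subset of `G`. -/
def RoughlyBranching {G : Type*} [Group G] (S : Finset G) (r : ℝ) (B : Set G) : Prop :=
  ∃ B' : Set G,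
    (∀ b ∈ B, ∃ b' ∈ B', (wordDist S b b' : ℝ) ≤ r) ∧
    ∀ k : ℕ, 1 ≤ k → ∀ g h : Fin k → G, (∀ i, g i ∈ B') → (∀ i, h i ∈ B') →
      (List.ofFn g).prod = (List.ofFn h).prod → g = h

/-- The `f`-halfspace `𝓗_{D,E,f}(u)` with radius parameters `(D, E)`. -/
def fHalf {X : Type*} [MetricSpace X] {G : Type*} [Group G] [MulAction G X]
    (S : Finset G) (ℓ : ℝ → X) (x₀ : X) (D E : ℝ) (u : G) : Set G :=
  {g : G | D < gromovProd x₀ (g • x₀) (u • x₀) ∨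
    ¬ ∃ h : G, (wordNorm S h : ℝ) ≤ E ∧
      250 * D ≤ projDist (h • Set.range ℓ) {x₀} {g • x₀}}

section HyperbolicGeometry

variable {X : Type*} [MetricSpace X]

theorem gromovProd_comm (w x y : X) : gromovProd w x y = gromovProd w y x := by
  simp only [gromovProd, dist_comm x y]; ring

theorem gromovProd_smul {G : Type*} [Group G] [MulAction G X]
    (hiso : ∀ (g : G) (x y : X), dist (g • x) (g • y) = dist x y) (g : G) (x y z : X) :
    gromovProd (g • x) (g • y) (g • z) = gromovProd x y z := by
  simp only [gromovProd, hiso]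

/-- The four-point form of hyperbolicity, with constant `η`. -/
def FourPoint (X : Type*) [MetricSpace X] (η : ℝ) : Prop :=
  ∀ w x y z : X, min (gromovProd w x y) (gromovProd w y z) - η ≤ gromovProd w x z

theorem FourPoint.le_of_lt {η : ℝ} (h : FourPoint X η) {w x y z : X} {c : ℝ}
    (hxz : gromovProd w x z ≤ c) (hyz : c + η < gromovProd w y z) :
    gromovProd w x y ≤ c + η := by
  have := h w x y z
  rcases min_le_iff.1 (by linarith : min (gromovProd w x y) (gromovProd w y z) ≤ c + η) with h | h
  · exact h
  · linarith

theorem FourPoint.le_of_le {η : ℝ} (h : FourPoint X η) {w x y z : X} {c : ℝ}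
    (hxy : c ≤ gromovProd w x y) (hyz : c ≤ gromovProd w y z) :
    c - η ≤ gromovProd w x z := by
  have := h w x y z
  have := le_min hxy hyz
  linarith

theorem GromovHyperbolic.nonneg {δ : ℝ} (hX : GromovHyperbolic X δ) (x : X) : 0 ≤ δ := by
  obtain ⟨γ, hγ⟩ := hX.1 x x
  obtain ⟨u, -, hu⟩ := hX.2 x x x γ γ γ hγ hγ hγ 0 (by simp)
  exact dist_nonneg.trans hu

theorem IsGeodesicBetween.dist_add_dist {γ : ℝ → X} {x y : X} (h : IsGeodesicBetween γ x y)
    {t : ℝ} (ht : t ∈ Set.Icc 0 (dist x y)) :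
    dist x (γ t) = t ∧ dist (γ t) y = dist x y - t := by
  obtain ⟨h0, h1, h2⟩ := h
  constructor
  · have := h2 0 ⟨le_rfl, dist_nonneg⟩ t ht
    rw [h0] at this
    rw [this, zero_sub, abs_neg, abs_of_nonneg ht.1]
  · have := h2 t ht _ ⟨dist_nonneg, le_rfl⟩
    rw [h1] at this
    rw [this, abs_sub_comm, abs_of_nonneg (by linarith [ht.2])]

theorem IsGeodesicBetween.gromovProd_le_dist {γ : ℝ → X} {x y : X} (h : IsGeodesicBetween γ x y)
    {t : ℝ} (ht : t ∈ Set.Icc 0 (dist x y)) (w : X) : gromovProd w x y ≤ dist w (γ t) := by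
  have := h.dist_add_dist ht
  have h1 := dist_triangle w (γ t) x
  have h2 := dist_triangle w (γ t) y
  rw [dist_comm (γ t) x] at h1
  unfold gromovProd
  linarith

theorem GromovHyperbolic.exists_dist_le {δ : ℝ} (hX : GromovHyperbolic X δ) {γ : ℝ → X} {x y : X}
    (hγ : IsGeodesicBetween γ x y) (w : X) :
    ∃ t ∈ Set.Icc 0 (dist x y), dist w (γ t) ≤ gromovProd w x y + 2 * δ + 1 := by
  have hδ := hX.nonneg x
  obtain ⟨γ₂, h₂⟩ := hX.1 x w
  obtain ⟨γ₃, h₃⟩ := hX.1 w y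
  have hthin := hX.2 x w y γ γ₂ γ₃ hγ h₂ h₃
  set T : Set ℝ := {t | t ∈ Set.Icc 0 (dist x y) ∧
    ∃ s ∈ Set.Icc (0 : ℝ) (dist x w), dist (γ t) (γ₂ s) ≤ δ} with hT
  have h0T : (0 : ℝ) ∈ T :=
    ⟨⟨le_rfl, dist_nonneg⟩, 0, ⟨le_rfl, dist_nonneg⟩, by rw [hγ.1, h₂.1, dist_self]; exact hδ⟩
  have hbdd : BddAbove T := ⟨dist x y, fun t ht => ht.1.2⟩
  obtain ⟨t₁, ht₁, hlt⟩ := exists_lt_of_lt_csSup ⟨0, h0T⟩ (by linarith : sSup T - 1 / 4 < sSup T)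
  obtain ⟨t₂, ht₂, h12, s, hs, hd⟩ : ∃ t₂ ∈ Set.Icc 0 (dist x y), |t₁ - t₂| ≤ 1 / 2 ∧
      ∃ s ∈ Set.Icc (0 : ℝ) (dist w y), dist (γ t₂) (γ₃ s) ≤ δ := by
    have hle := le_csSup hbdd ht₁
    rcases lt_or_ge (dist x y) (sSup T + 1 / 4) with h | h
    · refine ⟨dist x y, ⟨dist_nonneg, le_rfl⟩, ?_, dist w y, ⟨dist_nonneg, le_rfl⟩, ?_⟩
      · rw [abs_le]; constructor <;> linarith [ht₁.1.2]
      · rw [hγ.2.1, h₃.2.1, dist_self]; exact hδ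
    · have hmem : sSup T + 1 / 4 ∈ Set.Icc 0 (dist x y) := ⟨by linarith [ht₁.1.1], h⟩
      refine ⟨_, hmem, by rw [abs_le]; constructor <;> linarith, ?_⟩
      obtain ⟨u, ⟨s, hs, rfl⟩ | ⟨s, hs, rfl⟩, hu⟩ := hthin _ hmem
      · have : sSup T + 1 / 4 ≤ sSup T := le_csSup hbdd ⟨hmem, s, hs, hu⟩
        linarith
      · exact ⟨s, hs, hu⟩
  obtain ⟨ht₁, r, hr, hr'⟩ := ht₁
  refine ⟨t₁, ht₁, ?_⟩
  have e1 := hγ.dist_add_dist ht₁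
  have e2 := h₂.dist_add_dist hr
  have e3 := h₃.dist_add_dist hs
  have e4 : dist (γ t₁) (γ t₂) ≤ 1 / 2 := by rw [hγ.2.2 _ ht₁ _ ht₂]; exact h12
  have i1 := dist_triangle (γ t₁) (γ₂ r) x
  have i2 := dist_triangle (γ t₁) (γ₂ r) w
  have i3 := dist_triangle (γ t₁) (γ t₂) (γ₃ s)
  have i4 := dist_triangle (γ t₁) (γ₃ s) w
  have i5 := dist_triangle (γ t₁) (γ₃ s) y
  rw [dist_comm (γ t₁) x, dist_comm (γ₂ r) x] at i1
  rw [dist_comm (γ₃ s) w] at i4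
  rw [gromovProd, dist_comm w x, dist_comm w (γ t₁)]
  linarith

theorem GromovHyperbolic.fourPoint {δ : ℝ} (hX : GromovHyperbolic X δ) :
    FourPoint X (3 * δ + 1) := by
  intro w x y z
  obtain ⟨γ, hγ⟩ := hX.1 x z
  obtain ⟨γ₂, h₂⟩ := hX.1 x y
  obtain ⟨γ₃, h₃⟩ := hX.1 y z
  obtain ⟨t, ht, hw⟩ := hX.exists_dist_le hγ w
  obtain ⟨u, ⟨s, hs, rfl⟩ | ⟨s, hs, rfl⟩, hu⟩ := hX.2 x y z γ γ₂ γ₃ hγ h₂ h₃ t ht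
  · have := h₂.gromovProd_le_dist hs w
    have := min_le_left (gromovProd w x y) (gromovProd w y z)
    linarith [dist_triangle w (γ t) (γ₂ s)]
  · have := h₃.gromovProd_le_dist hs w
    have := min_le_right (gromovProd w x y) (gromovProd w y z)
    linarith [dist_triangle w (γ t) (γ₃ s)]

/-- Projection to a geodesic line: the nearest point lies close to every geodesic to the line. -/
theorem GromovHyperbolic.gromovProd_nearest_le {δ : ℝ} (hX : GromovHyperbolic X δ) {ℓ : ℝ → X}
    (hgeo : ∀ s t : ℝ, dist (ℓ s) (ℓ t) = |s - t|) {x : X} {s : ℝ}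
    (hs : ∀ r, dist x (ℓ s) ≤ dist x (ℓ r)) (r : ℝ) :
    gromovProd (ℓ s) x (ℓ r) ≤ 2 * δ + 1 := by
  obtain ⟨e, he, her⟩ : ∃ e : ℝ, |e| = 1 ∧ s + e * |s - r| = r := by
    rcases le_total s r with h | h
    · exact ⟨1, by simp, by rw [abs_of_nonpos (by linarith)]; ring⟩
    · exact ⟨-1, by simp, by rw [abs_of_nonneg (by linarith)]; ring⟩
  have hγ : IsGeodesicBetween (fun t => ℓ (s + e * t)) (ℓ s) (ℓ r) := by
    refine ⟨by simp, by simp only [hgeo]; rw [her], fun a _ b _ => ?_⟩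
    simp only [hgeo]
    rw [show s + e * a - (s + e * b) = e * (a - b) by ring, abs_mul, he, one_mul]
  obtain ⟨t, -, ht⟩ := hX.exists_dist_le hγ x
  have := hs (s + e * t)
  simp only [gromovProd] at ht ⊢
  rw [dist_comm (ℓ s) x]
  linarith

/-- Two points close to a geodesic from `x` to `y` and at similar distance from `x` are close. -/
theorem FourPoint.dist_le {η : ℝ} (h : FourPoint X η) {o z a b : X} {c r : ℝ}
    (ha : gromovProd a o z ≤ c) (hb : gromovProd b o z ≤ c) (hr : |dist o a - dist o b| ≤ r) :
    dist a b ≤ r + 2 * c + 2 * η := by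
  have h1 := h o a z b
  rw [abs_le] at hr
  simp only [gromovProd, dist_comm a o, dist_comm b o, dist_comm z b] at *
  rcases min_le_iff.1 (le_of_eq (rfl : min ((dist o a + dist o z - dist a z) / 2)
    ((dist o z + dist o b - dist b z) / 2) = _)) with h2 | h2 <;> linarith

end HyperbolicGeometry

theorem zpow_smul_axis {X G : Type*} [Group G] [MulAction G X] {f : G} {ℓ : ℝ → X}
    (haxis : ∀ t : ℝ, f • ℓ t = ℓ (t + 1)) (n : ℤ) (t : ℝ) :
    f ^ n • ℓ t = ℓ (t + n) := by
  induction n using Int.induction_on generalizing t with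
  | zero => simp
  | succ k ih =>
    rw [zpow_add_one, mul_smul, haxis, ih]; congr 1; push_cast; ring
  | pred k ih =>
    have h : f⁻¹ • ℓ t = ℓ (t - 1) := by
      rw [inv_smul_eq_iff, haxis, sub_add_cancel]
    rw [zpow_sub_one, mul_smul, h, ih]; congr 1; push_cast; ring

section Axis

variable {X : Type*} [MetricSpace X]

/-- If the projections of `x` and `y` to a geodesic line are far apart, then a geodesic from `x`
to `y` follows the line between these projections. -/
theorem FourPoint.gromovProd_le_of_between {η : ℝ} (h4 : FourPoint X η) {ℓ : ℝ → X}
    (hgeo : ∀ s t : ℝ, dist (ℓ s) (ℓ t) = |s - t|) {x y : X} {s e d r : ℝ}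
    (he : e = 1 ∨ e = -1)
    (hx : ∀ t, gromovProd (ℓ s) x (ℓ t) ≤ η) (hy : ∀ t, gromovProd (ℓ (s + e * d)) y (ℓ t) ≤ η)
    (hη : 0 < η) (hr : 4 * η ≤ r) (hrd : r ≤ d - 4 * η) :
    gromovProd (ℓ (s + e * r)) x y ≤ 2 * η := by
  have e1 : dist (ℓ (s + e * r)) (ℓ s) = r := by
    rw [hgeo]; rcases he with rfl | rfl
    · rw [abs_of_nonneg] <;> linarith
    · rw [abs_of_nonpos] <;> linarith
  have e2 : dist (ℓ (s + e * r)) (ℓ (s + e * d)) = d - r := by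
    rw [hgeo]; rcases he with rfl | rfl
    · rw [abs_of_nonpos] <;> linarith
    · rw [abs_of_nonneg] <;> linarith
  have e3 : dist (ℓ s) (ℓ (s + e * d)) = d := by
    rw [hgeo]; rcases he with rfl | rfl
    · rw [abs_of_nonpos] <;> linarith
    · rw [abs_of_nonneg] <;> linarith
  have h0 : gromovProd (ℓ (s + e * r)) (ℓ s) (ℓ (s + e * d)) ≤ 0 := by
    rw [gromovProd, e1, e2, e3]; linarith
  have h1 := hx (s + e * r)
  have h2 := hy (s + e * r)
  have h3 : gromovProd (ℓ (s + e * r)) (ℓ s) y ≤ 0 + η := by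
    refine h4.le_of_lt h0 ?_
    simp only [gromovProd, dist_comm y, dist_comm (ℓ (s + e * d)) (ℓ (s + e * r))] at h2 ⊢
    linarith
  rw [gromovProd_comm]
  have h5 : gromovProd (ℓ (s + e * r)) y x ≤ (0 + η) + η := by
    refine h4.le_of_lt (z := ℓ s) (by rwa [gromovProd_comm]) ?_
    simp only [gromovProd, dist_comm (ℓ s)] at h1 ⊢
    rw [dist_comm x (ℓ s), dist_comm x (ℓ (s + e * r))] at *
    simp only [dist_comm (ℓ s)] at *
    linarith
  linarith

theorem FourPoint.gromovProd_line_le {η : ℝ} (h4 : FourPoint X η) {ℓ : ℝ → X}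
    (hgeo : ∀ s t : ℝ, dist (ℓ s) (ℓ t) = |s - t|) {x : X} {s e d r : ℝ}
    (he : e = 1 ∨ e = -1) (hx : ∀ t, gromovProd (ℓ s) x (ℓ t) ≤ η)
    (hη : 0 < η) (hr : 4 * η ≤ r) (hrd : r ≤ d) :
    gromovProd (ℓ (s + e * r)) x (ℓ (s + e * d)) ≤ η := by
  have e1 : dist (ℓ (s + e * r)) (ℓ s) = r := by
    rw [hgeo]; rcases he with rfl | rfl
    · rw [abs_of_nonneg] <;> linarith
    · rw [abs_of_nonpos] <;> linarith
  have e2 : dist (ℓ (s + e * r)) (ℓ (s + e * d)) = d - r := by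
    rw [hgeo]; rcases he with rfl | rfl
    · rw [abs_of_nonpos] <;> linarith
    · rw [abs_of_nonneg] <;> linarith
  have e3 : dist (ℓ s) (ℓ (s + e * d)) = d := by
    rw [hgeo]; rcases he with rfl | rfl
    · rw [abs_of_nonpos] <;> linarith
    · rw [abs_of_nonneg] <;> linarith
  have h0 : gromovProd (ℓ (s + e * r)) (ℓ (s + e * d)) (ℓ s) ≤ 0 := by
    rw [gromovProd, dist_comm (ℓ (s + e * d)), e1, e2, e3]; linarith
  have h1 := hx (s + e * r)
  rw [gromovProd_comm]
  have h5 : gromovProd (ℓ (s + e * r)) (ℓ (s + e * d)) x ≤ 0 + η := by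
    refine h4.le_of_lt h0 ?_
    simp only [gromovProd] at h1 ⊢
    rw [dist_comm (ℓ s) (ℓ (s + e * r)), dist_comm (ℓ s) x, e1] at h1
    rw [dist_comm (ℓ (s + e * r)) x, e1]
    linarith
  linarith

variable {G : Type*} [Group G] [MulAction G X]

/-- A geodesic from `x₀` to `g • x₀` follows the translated axis `β • ℓ` in the direction `σ`, from
`β • x₀` on, for a length of at least `120 * D`. -/
def FollowsAxis (f : G) (x₀ : X) (η D : ℝ) (β : G) (σ : ℤ) (g : G) : Prop :=
  ∀ m : ℕ, (m : ℝ) ≤ 120 * D →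
    gromovProd ((β * f ^ (σ * m)) • x₀) x₀ (g • x₀) ≤ 2 * η ∧
    gromovProd (β • x₀) x₀ ((β * f ^ (σ * m)) • x₀) ≤ η

theorem exists_followsAxis {δ η : ℝ} (hX : GromovHyperbolic X δ) (h4 : FourPoint X η)
    (hη : 0 < η) (hδη : 2 * δ + 1 ≤ η)
    (hiso : ∀ (g : G) (x y : X), dist (g • x) (g • y) = dist x y)
    {f : G} {ℓ : ℝ → X} (hgeo : ∀ s t : ℝ, dist (ℓ s) (ℓ t) = |s - t|)
    (haxis : ∀ t : ℝ, f • ℓ t = ℓ (t + 1)) {x₀ : X} (hx₀ : x₀ ∈ Set.range ℓ)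
    {D : ℝ} (hD : 20 * η + 20 ≤ D) {g h : G}
    (hproj : 250 * D ≤ projDist (h • Set.range ℓ) {x₀} {g • x₀}) :
    ∃ n : ℤ, |(n : ℝ)| ≤ 2 * dist x₀ (h • x₀) + 4 * η + 1 ∧
      ∃ σ : ℤ, (σ = 1 ∨ σ = -1) ∧ FollowsAxis f x₀ η D (h * f ^ n) σ g := by
  obtain ⟨τ, rfl⟩ := hx₀
  set L : ℝ → X := fun t => h • ℓ t with hL
  have hLgeo : ∀ s t : ℝ, dist (L s) (L t) = |s - t| := fun s t => by rw [hL]; simp [hiso, hgeo]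
  have hLmul : ∀ n : ℤ, (h * f ^ n) • ℓ τ = L (τ + n) := fun n => by
    rw [mul_smul, zpow_smul_axis haxis]
  have hnear : ∀ x p, p ∈ nearestPts (h • Set.range ℓ) x →
      ∃ s, p = L s ∧ ∀ t, dist x (L s) ≤ dist x (L t) := by
    rintro x p ⟨⟨_, ⟨s, rfl⟩, rfl⟩, hp⟩
    refine ⟨s, rfl, fun t => ?_⟩
    exact hp.le.trans (Metric.infDist_le_dist_of_mem ⟨_, ⟨t, rfl⟩, rfl⟩)
  have hnear' : ∀ x s, (∀ t, dist x (L s) ≤ dist x (L t)) →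
      ∀ t, gromovProd (L s) x (L t) ≤ η :=
    fun x s hs t => (hX.gromovProd_nearest_le hLgeo hs t).trans hδη
  have hsame : ∀ x s t, (∀ r, dist x (L s) ≤ dist x (L r)) → (∀ r, dist x (L t) ≤ dist x (L r)) →
      dist (L s) (L t) ≤ 2 * η := by
    intro x s t hs ht
    have := hnear' x s hs t
    have := hs t
    have := ht s
    simp only [gromovProd, dist_comm (L s) x] at *
    linarith
  have key : ∃ s s', (∀ r, dist (ℓ τ) (L s) ≤ dist (ℓ τ) (L r)) ∧
      (∀ r, dist (g • ℓ τ) (L s') ≤ dist (g • ℓ τ) (L r)) ∧ 249 * D < dist (L s) (L s') := by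
    obtain ⟨p, hp, q, hq, hpq⟩ : ∃ p ∈ projSet (h • Set.range ℓ) ({ℓ τ} ∪ {g • ℓ τ}),
        ∃ q ∈ projSet (h • Set.range ℓ) ({ℓ τ} ∪ {g • ℓ τ}), 249 * D < dist p q := by
      by_contra! hcon
      have := Metric.diam_le_of_forall_dist_le (by linarith) hcon
      rw [projDist] at hproj
      linarith
    simp only [projSet, Set.mem_iUnion, exists_prop] at hp hq
    obtain ⟨x, hx, hp⟩ := hp
    obtain ⟨y, hy, hq⟩ := hq
    obtain ⟨s, rfl, hs⟩ := hnear _ _ hp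
    obtain ⟨t, rfl, ht⟩ := hnear _ _ hq
    rcases hx with rfl | rfl <;> rcases hy with rfl | rfl
    · have := hsame _ _ _ hs ht; linarith
    · exact ⟨s, t, hs, ht, hpq⟩
    · exact ⟨t, s, ht, hs, by rwa [dist_comm]⟩
    · have := hsame _ _ _ hs ht; linarith
  obtain ⟨s, s', hs, hs', hlong⟩ := key
  rw [hLgeo] at hlong
  obtain ⟨σ, hσ, hσs⟩ : ∃ σ : ℤ, (σ = 1 ∨ σ = -1) ∧ s + (σ : ℝ) * |s - s'| = s' := by
    rcases le_total s s' with hle | hle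
    · exact ⟨1, Or.inl rfl, by rw [abs_of_nonpos (by linarith)]; push_cast; ring⟩
    · exact ⟨-1, Or.inr rfl, by rw [abs_of_nonneg (by linarith)]; push_cast; ring⟩
  have hσ' : (σ : ℝ) = 1 ∨ (σ : ℝ) = -1 := by rcases hσ with rfl | rfl <;> simp
  obtain ⟨n, r, hr, hr', hn⟩ : ∃ (n : ℤ) (r : ℝ), 4 * η ≤ r ∧ r ≤ 4 * η + 1 ∧
      τ + n = s + σ * r := by
    rcases hσ' with h1 | h1 <;> rw [h1]
    · refine ⟨⌈s + 4 * η - τ⌉, ⌈s + 4 * η - τ⌉ + τ - s, ?_, ?_, by ring⟩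
      · linarith [Int.le_ceil (s + 4 * η - τ)]
      · linarith [Int.ceil_lt_add_one (s + 4 * η - τ)]
    · refine ⟨⌊s - 4 * η - τ⌋, s - τ - ⌊s - 4 * η - τ⌋, ?_, ?_, by ring⟩
      · linarith [Int.floor_le (s - 4 * η - τ)]
      · linarith [Int.lt_floor_add_one (s - 4 * η - τ)]
  have hpos : ∀ m : ℕ, (h * f ^ n * f ^ (σ * m)) • ℓ τ = L (s + σ * (r + m)) := by
    intro m
    rw [mul_assoc, ← zpow_add, hLmul]
    congr 1
    push_cast
    linarith
  have hpos0 : (h * f ^ n) • ℓ τ = L (s + σ * r) := by rw [hLmul, hn]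
  refine ⟨n, ?_, σ, hσ, fun m hm => ⟨?_, ?_⟩⟩
  · have e1 : dist (L τ) (L (τ + n)) = |(n : ℝ)| := by rw [hLgeo, ← abs_neg]; congr 1; ring
    have e2 : dist (L s) (L (s + σ * r)) = r := by
      rw [hLgeo]; rcases hσ' with h1 | h1 <;> rw [h1]
      · rw [abs_of_nonpos] <;> linarith
      · rw [abs_of_nonneg] <;> linarith
    rw [← e1, hn]
    have i1 := dist_triangle (L τ) (ℓ τ) (L (s + σ * r))
    have i2 := dist_triangle (ℓ τ) (L s) (L (s + σ * r))
    have i3 := hs τ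
    rw [dist_comm (L τ) (ℓ τ)] at i1
    change _ ≤ 2 * dist (ℓ τ) (L τ) + _ + _
    linarith
  · rw [hpos]
    have hm0 : (0 : ℝ) ≤ m := Nat.cast_nonneg m
    refine h4.gromovProd_le_of_between (d := |s - s'|) hLgeo hσ' (hnear' _ _ hs) ?_ hη
      (by linarith) (by linarith)
    rw [hσs]
    exact hnear' _ _ hs'
  · rw [hpos, hpos0]
    have hm0 : (0 : ℝ) ≤ m := Nat.cast_nonneg m
    exact h4.gromovProd_line_le hLgeo hσ' (hnear' _ _ hs) hη hr (by linarith)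

end Axis

section Counting

open Finset in
open Classical in
/-- A finite directed graph of outdegree at most `M` has a large independent set. -/
theorem exists_independent_of_outdegree_le {α : Type*} (r : α → α → Prop) (M : ℕ) (B : Finset α)
    (h : ∀ a ∈ B, #{b ∈ B | r a b} ≤ M) :
    ∃ I ⊆ B, (∀ a ∈ I, ∀ b ∈ I, a ≠ b → ¬ r a b) ∧ #B ≤ (2 * M + 1) * #I := by
  induction B using Finset.strongInduction with
  | H B ih =>
    rcases B.eq_empty_or_nonempty with rfl | hB
    · exact ⟨∅, by simp⟩
    obtain ⟨b, hb, hin⟩ : ∃ b ∈ B, #{a ∈ B | r a b} ≤ M := by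
      apply Finset.exists_le_of_sum_le hB
      have := Finset.sum_card_bipartiteAbove_eq_sum_card_bipartiteBelow (s := B) (t := B) r
      simp only [bipartiteAbove, bipartiteBelow] at this
      rw [← this]
      exact Finset.sum_le_sum h
    set Z : Finset α := insert b ({a ∈ B | r b a} ∪ {a ∈ B | r a b}) with hZ
    have hZcard : #Z ≤ 2 * M + 1 := by
      have h1 := Finset.card_insert_le b ({a ∈ B | r b a} ∪ {a ∈ B | r a b})
      have h2 := Finset.card_union_le {a ∈ B | r b a} {a ∈ B | r a b}
      have h3 := h b hb
      rw [← hZ] at h1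
      omega
    have hbZ : b ∈ Z := Finset.mem_insert_self _ _
    have hss : B \ Z ⊂ B := by
      refine Finset.ssubset_iff_subset_ne.2 ⟨Finset.sdiff_subset, fun heq => ?_⟩
      exact (Finset.mem_sdiff.1 (heq.symm ▸ hb : b ∈ B \ Z)).2 hbZ
    obtain ⟨I, hI, hind, hcard⟩ := ih _ hss fun a ha =>
      (Finset.card_le_card (Finset.filter_subset_filter _ hss.1)).trans (h a (hss.1 ha))
    have hout : ∀ a ∈ I, a ≠ b ∧ ¬ r b a ∧ ¬ r a b := by
      intro a ha
      have ha' := Finset.mem_sdiff.1 (hI ha)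
      simp only [hZ, Finset.mem_insert, Finset.mem_union, Finset.mem_filter, ha'.1, true_and,
        not_or] at ha'
      exact ha'
    refine ⟨insert b I, Finset.insert_subset hb (hI.trans hss.1), ?_, ?_⟩
    · intro a ha c hc hac
      rcases Finset.mem_insert.1 ha with rfl | ha' <;>
        rcases Finset.mem_insert.1 hc with rfl | hc'
      · exact absurd rfl hac
      · exact (hout c hc').2.1
      · exact (hout a ha').2.2
      · exact hind a ha' c hc' hac
    · rw [Finset.card_insert_of_notMem fun hbI => (hout b hbI).1 rfl]
      have := Finset.card_le_card_sdiff_add_card (s := B) (t := Z)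
      rw [mul_add]
      omega

variable {X : Type*} [MetricSpace X]

/-- If `c` lies behind both `a` and `w` as seen from `o`, and `w` is much farther from `o` than
`a`, then `w` and `c` lie in the same direction from `a`. -/
theorem le_gromovProd_of_dist_add_le {o a w c : X} {θ Λ : ℝ} (hw : gromovProd w o c ≤ θ)
    (haw : dist o a + Λ ≤ dist o w) : Λ - θ ≤ gromovProd a w c := by
  have h1 := dist_triangle o a w
  have h2 := dist_triangle o a c
  simp only [gromovProd, dist_comm w o] at *
  linarith

open Finset in
open Classical in
/-- The counting argument behind the magic lemma. -/
theorem FourPoint.card_mul_le {ι : Type*} {η D Λ : ℝ} {N : ℕ} (h4 : FourPoint X η) (hη : 0 < η)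
    (P : ι → X) (o : X) (A B : Finset ι) (hBA : B ⊆ A) (u : Fin 2 → ι → X) (t : Fin 2 → ℝ)
    (W : ι → ℕ) (ht : ∀ i, D + 4 * η < t i) (hΛ : ∀ i, t i + D + 4 * η < Λ)
    (ho : ∀ a ∈ B, ∀ i, gromovProd (P a) o (u i a) ≤ D + η)
    (h01 : ∀ a ∈ B, gromovProd (P a) (u 0 a) (u 1 a) ≤ D)
    (hN : ∀ a ∈ B, ∀ i, N ≤ #{c ∈ A | t i ≤ gromovProd (P a) (P c) (u i a)})
    (hW : ∀ a ∈ B, ∀ b ∈ B, W a < W b → dist o (P a) + Λ ≤ dist o (P b))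
    (hind : ∀ a ∈ B, ∀ b ∈ B, W a = W b → a ≠ b → ∀ z ∈ A, ∀ i j,
      t i - η ≤ gromovProd (P a) (P z) (u i a) → ¬ t j - η ≤ gromovProd (P b) (P z) (u j b)) :
    N * #B ≤ 2 * #A := by
  -- `w` lies in the (thickened) `i`-th direction from `a`
  let dir : Fin 2 → ι → ι → Prop := fun i a w => t i - η ≤ gromovProd (P a) (P w) (u i a)
  have hback : ∀ a ∈ B, ∀ i w, dir i a w → gromovProd (P a) o (P w) ≤ D + 2 * η := by
    intro a ha i w hw
    have := h4.le_of_lt (y := P w) (ho a ha i) (by have := ht i; dsimp only [dir] at hw; linarith)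
    linarith
  have hdisj : ∀ a ∈ B, ∀ w, dir 0 a w → ¬ dir 1 a w := by
    intro a ha w h0 h1
    have h2 := h4.le_of_lt (y := P w) (h01 a ha)
      (by have := ht 1; dsimp only [dir] at h1; linarith)
    rw [gromovProd_comm] at h2
    have := ht 0
    dsimp only [dir] at h0
    linarith
  -- the candidates for a parent of `w`
  let cand : ι → Finset ι := fun w => {p ∈ B | W p < W w ∧ ∃ i, dir i p w}
  obtain ⟨par, hpar⟩ : ∃ par : ι → ι, ∀ w, (cand w).Nonempty →
      par w ∈ cand w ∧ ∀ p ∈ cand w, W p ≤ W (par w) := by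
    have : ∀ w, ∃ q, (cand w).Nonempty → q ∈ cand w ∧ ∀ p ∈ cand w, W p ≤ W q := by
      intro w
      by_cases h : (cand w).Nonempty
      · obtain ⟨q, hq⟩ := Finset.exists_max_image (cand w) W h
        exact ⟨q, fun _ => hq⟩
      · exact ⟨w, fun h' => absurd h' h⟩
    choose par hpar using this
    exact ⟨par, hpar⟩
  let child : ι → Finset ι := fun a => {w ∈ B | (cand w).Nonempty ∧ par w = a}
  let light : Finset ι := {a ∈ B | ∃ i, ∀ w ∈ child a, ¬ dir i a w}
  have hlight : #B ≤ 2 * #light := by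
    have h1 : ∑ a ∈ B, #(child a) ≤ #B := by
      rw [← Finset.card_biUnion]
      · refine Finset.card_le_card fun w hw => ?_
        obtain ⟨a, -, hw⟩ := Finset.mem_biUnion.1 hw
        exact (Finset.mem_filter.1 hw).1
      · intro a _ b _ hab
        refine Finset.disjoint_left.2 fun w hwa hwb => hab ?_
        rw [← (Finset.mem_filter.1 hwa).2.2, (Finset.mem_filter.1 hwb).2.2]
    have h2 : ∑ a ∈ B \ light, 2 ≤ ∑ a ∈ B \ light, #(child a) := by
      refine Finset.sum_le_sum fun a ha => ?_
      obtain ⟨haB, hal⟩ := Finset.mem_sdiff.1 ha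
      have hal' : ∀ i, ∃ w ∈ child a, dir i a w := by
        intro i
        by_contra! hcon
        exact hal (Finset.mem_filter.2 ⟨haB, i, hcon⟩)
      obtain ⟨w₀, hw₀, hd₀⟩ := hal' 0
      obtain ⟨w₁, hw₁, hd₁⟩ := hal' 1
      refine Finset.one_lt_card.2 ⟨w₀, hw₀, w₁, hw₁, ?_⟩
      rintro rfl
      exact hdisj a haB _ hd₀ hd₁
    have h3 : ∑ a ∈ B \ light, #(child a) ≤ ∑ a ∈ B, #(child a) :=
      Finset.sum_le_sum_of_subset Finset.sdiff_subset
    have h4 := Finset.card_le_card_sdiff_add_card (s := B) (t := light)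
    simp only [Finset.sum_const, smul_eq_mul] at h2
    omega
  -- a descendant of `a` in the direction of `c` gives a child of `a` in this direction
  have hchild : ∀ a ∈ B, ∀ i, ∀ c, t i ≤ gromovProd (P a) (P c) (u i a) →
      ∀ n, ∀ w ∈ B, W w = n → W a < W w → gromovProd (P w) o (P c) ≤ D + 3 * η →
        ∃ w ∈ child a, dir i a w := by
    intro a ha i c hc n
    induction n using Nat.strong_induction_on with
    | _ n ih =>
      intro w hw hn haw hwc
      have hdirw : dir i a w := by
        refine h4.le_of_le (y := P c) ?_ hc
        have := le_gromovProd_of_dist_add_le hwc (hW a ha w hw haw)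
        have := hΛ i
        linarith
      have hac : a ∈ cand w := Finset.mem_filter.2 ⟨ha, haw, i, hdirw⟩
      obtain ⟨hp, hmax⟩ := hpar w ⟨a, hac⟩
      have hle := hmax a hac
      obtain ⟨hpB, hpw, j, hj⟩ := Finset.mem_filter.1 hp
      rcases hle.eq_or_lt with heq | hlt
      · refine ⟨w, Finset.mem_filter.2 ⟨hw, ⟨a, hac⟩, ?_⟩, hdirw⟩
        by_contra hne
        exact hind a ha (par w) hpB heq (Ne.symm hne) w (hBA hw) i j hdirw hj
      · refine ih _ (hn ▸ hpw) (par w) hpB rfl hlt ?_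
        have h1 := le_gromovProd_of_dist_add_le hwc (hW _ hpB w hw hpw)
        have h2 := hback _ hpB j w hj
        have h3 := h4.le_of_lt (w := P (par w)) (x := o) (y := P c) (z := P w) h2 (by
          rw [gromovProd_comm]
          have := hΛ i
          have := ht i
          linarith)
        linarith
  have hblock : ∀ a ∈ light, ∃ i, ∀ w ∈ child a, ¬ dir i a w := fun a ha =>
    (Finset.mem_filter.1 ha).2
  choose! k hk using hblock
  let block : ι → Finset ι := fun a => {c ∈ A | t (k a) ≤ gromovProd (P a) (P c) (u (k a) a)}
  have hlt : ∀ a ∈ light, ∀ b ∈ light, W a < W b → ∀ c ∈ block a, c ∉ block b := by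
    intro a ha b hb hab c hca hcb
    have haB := (Finset.mem_filter.1 ha).1
    have hbB := (Finset.mem_filter.1 hb).1
    have hca := (Finset.mem_filter.1 hca).2
    have hcb := (Finset.mem_filter.1 hcb).2
    obtain ⟨w, hw, hd⟩ := hchild a haB (k a) c hca _ b hbB rfl hab (by
      have := hback b hbB (k b) c (by dsimp only [dir]; linarith)
      linarith)
    exact hk a ha w hw hd
  have hdisjoint : (light : Set ι).PairwiseDisjoint block := by
    intro a ha b hb hab
    refine Finset.disjoint_left.2 fun c hca hcb => ?_
    rcases lt_trichotomy (W a) (W b) with h | h | h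
    · exact hlt a ha b hb h c hca hcb
    · obtain ⟨hcA, hca⟩ := Finset.mem_filter.1 hca
      have hcb := (Finset.mem_filter.1 hcb).2
      exact hind a (Finset.mem_filter.1 ha).1 b (Finset.mem_filter.1 hb).1 h hab c hcA _ _
        (by linarith) (by linarith : t (k b) - η ≤ _)
    · exact hlt b hb a ha h c hcb hca
  have hfinal : #light * N ≤ #A := by
    calc #light * N = ∑ a ∈ light, N := by simp
      _ ≤ ∑ a ∈ light, #(block a) :=
        Finset.sum_le_sum fun a ha => hN a (Finset.mem_filter.1 ha).1 _
      _ = #(light.biUnion block) := (Finset.card_biUnion hdisjoint).symm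
      _ ≤ #A := Finset.card_le_card (Finset.biUnion_subset.2 fun a _ => Finset.filter_subset _ _)
  calc N * #B ≤ N * (2 * #light) := Nat.mul_le_mul_left _ hlight
    _ = 2 * (#light * N) := by ring
    _ ≤ 2 * #A := Nat.mul_le_mul_left _ hfinal

end Counting

section Conflicts

variable {X : Type*} [MetricSpace X]

/-- Two geodesics, issuing from nearby points, towards points in a common direction follow the same
points. -/
theorem FourPoint.gromovProd_le_of_common_direction {η : ℝ} (h4 : FourPoint X η) (hη : 0 < η)
    {D s m : ℝ} (hD : 20 * η + 20 ≤ D) (hs : 0 ≤ s) (hm : 10 * D ≤ m) (hm' : m ≤ 90 * D)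
    {o a b y z u v : X} (ha : gromovProd a o z ≤ D + 2 * η) (hb : gromovProd b o z ≤ D + 2 * η)
    (hab : |dist o a - dist o b| ≤ 1) (hu : s + 100 * D - η ≤ gromovProd a z u)
    (hv : s + 100 * D - η ≤ gromovProd b z v) (hy : gromovProd y a u ≤ 2 * η)
    (hay : dist a y ≤ s + m) (hay' : s + m - 4 * η ≤ dist a y) :
    gromovProd y b v ≤ 5 * η ∧ dist b y ≤ s + 100 * D := by
  have hdist := h4.dist_le ha hb hab
  have t1 := dist_triangle b a y
  have t2 := dist_triangle a b y
  rw [dist_comm b a] at t1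
  have h1 : dist a y - 2 * η - η ≤ gromovProd a y z := by
    refine h4.le_of_le (y := u) ?_ (by rw [gromovProd_comm]; linarith)
    simp only [gromovProd, dist_comm y a] at hy ⊢
    linarith
  have h2 : gromovProd y z a ≤ 3 * η := by
    simp only [gromovProd, dist_comm y a, dist_comm z a] at h1 ⊢
    linarith
  have h3 : gromovProd y z b ≤ 3 * η + η := by
    refine h4.le_of_lt h2 ?_
    simp only [gromovProd, dist_comm y a, dist_comm y b, dist_comm b a]
    linarith
  have h5 : dist b y ≤ s + 100 * D := by linarith
  have h6 : dist b y - 4 * η - η ≤ gromovProd b y v := by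
    refine h4.le_of_le (y := z) ?_ (by linarith)
    simp only [gromovProd, dist_comm y b, dist_comm z b] at h3 ⊢
    linarith
  refine ⟨?_, h5⟩
  simp only [gromovProd, dist_comm y b] at h6 ⊢
  linarith

variable {G : Type*} [Group G] [MulAction G X]

/-- Only few translates of a long segment of the axis of a WPD element follow a given geodesic. -/
theorem FourPoint.card_le_of_wpd {η : ℝ} (h4 : FourPoint X η)
    (hiso : ∀ (g : G) (x y : X), dist (g • x) (g • y) = dist x y) {h : G} {x₀ : X} {R c : ℝ}
    (hR : 1 + 2 * c + 2 * η < R)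
    (hfin : {g : G | dist x₀ (g • x₀) < R ∧ dist (h • x₀) ((g * h) • x₀) < R}.Finite)
    {b : G} {v w : X} {K : ℕ} (T : Finset G)
    (hT : ∀ a ∈ T, gromovProd ((a * b) • x₀) v w ≤ c ∧ dist v ((a * b) • x₀) < K)
    (hT' : ∀ a ∈ T, gromovProd ((a * b * h) • x₀) v w ≤ c ∧ dist v ((a * b * h) • x₀) < K) :
    T.card ≤ hfin.toFinset.card * (K * K) := by
  classical
  have key := Finset.card_le_mul_card_image_of_maps_to (s := T)
    (t := Finset.range K ×ˢ Finset.range K)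
    (f := fun a => (⌊dist v ((a * b) • x₀)⌋₊, ⌊dist v ((a * b * h) • x₀)⌋₊)) (fun a ha => by
      simp only [Finset.mem_product, Finset.mem_range]
      exact ⟨(Nat.floor_lt dist_nonneg).2 (hT a ha).2, (Nat.floor_lt dist_nonneg).2 (hT' a ha).2⟩)
    hfin.toFinset.card ?_
  · simpa using key
  · rintro ⟨i, j⟩ -
    rcases Finset.eq_empty_or_nonempty (T.filter fun a =>
      (⌊dist v ((a * b) • x₀)⌋₊, ⌊dist v ((a * b * h) • x₀)⌋₊) = (i, j)) with h0 | ⟨a₁, h₁⟩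
    · rw [h0]; simp
    have hfloor : ∀ p q : ℝ, 0 ≤ p → 0 ≤ q → ⌊p⌋₊ = ⌊q⌋₊ → |p - q| ≤ 1 := by
      intro p q hp hq h
      have h1 := Nat.floor_le hp
      have h2 := Nat.floor_le hq
      have h3 := Nat.lt_floor_add_one p
      have h4 := Nat.lt_floor_add_one q
      rw [h] at h1 h3
      rw [abs_le]; constructor <;> linarith
    have hsub : ∀ (g : G) (y : X), dist y (((a₁ * b)⁻¹ * g) • x₀) = dist ((a₁ * b) • y) (g • x₀) := by
      intro g y
      rw [← hiso (a₁ * b), ← mul_smul, mul_inv_cancel_left]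
    refine Finset.card_le_card_of_injOn (fun a => (a₁ * b)⁻¹ * (a * b)) ?_ ?_
    · intro a ha
      simp only [Finset.coe_filter, Set.mem_ofPred_eq, Finset.mem_filter, Prod.mk.injEq] at ha h₁
      obtain ⟨h₁, e1, e2⟩ := h₁
      obtain ⟨ha, e3, e4⟩ := ha
      simp only [Set.Finite.coe_toFinset, Set.mem_ofPred_eq]
      rw [mul_assoc, hsub, hsub, ← mul_smul]
      constructor
      · have := h4.dist_le (hT a₁ h₁).1 (hT a ha).1
          (hfloor _ _ dist_nonneg dist_nonneg (e1.trans e3.symm))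
        linarith
      · have := h4.dist_le (hT' a₁ h₁).1 (hT' a ha).1
          (hfloor _ _ dist_nonneg dist_nonneg (e2.trans e4.symm))
        linarith
    · intro a _ a' _ haa
      simpa using haa

theorem FollowsAxis.dist_le {f : G} {x₀ : X} {η D : ℝ} {β g : G} {σ : ℤ}
    (hiso : ∀ (g : G) (x y : X), dist (g • x) (g • y) = dist x y)
    (hf : ∀ n : ℤ, dist x₀ (f ^ n • x₀) = |(n : ℝ)|) (hσ : σ = 1 ∨ σ = -1)
    (h : FollowsAxis f x₀ η D β σ g) {m : ℕ} (hm : (m : ℝ) ≤ 120 * D) :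
    dist x₀ ((β * f ^ (σ * m)) • x₀) ≤ dist x₀ (β • x₀) + m ∧
      dist x₀ (β • x₀) + m - 2 * η ≤ dist x₀ ((β * f ^ (σ * m)) • x₀) := by
  have h1 := (h m hm).2
  have h2 : dist (β • x₀) ((β * f ^ (σ * m)) • x₀) = m := by
    rw [mul_smul, hiso, hf]
    rcases hσ with rfl | rfl <;> simp
  have h3 := dist_triangle x₀ (β • x₀) ((β * f ^ (σ * m)) • x₀)
  rw [gromovProd, h2, dist_comm (β • x₀)] at h1
  constructor <;> linarith

theorem FollowsAxis.le_gromovProd {f : G} {x₀ : X} {η D : ℝ} {β g g' : G} {σ : ℤ}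
    (h4 : FourPoint X η)
    (hiso : ∀ (g : G) (x y : X), dist (g • x) (g • y) = dist x y)
    (hf : ∀ n : ℤ, dist x₀ (f ^ n • x₀) = |(n : ℝ)|) (hσ : σ = 1 ∨ σ = -1)
    (hη : 0 < η) (hD : 20 * η + 20 ≤ D)
    (h : FollowsAxis f x₀ η D β σ g) (h' : FollowsAxis f x₀ η D β σ g') :
    dist x₀ (β • x₀) + 100 * D ≤ gromovProd x₀ (g • x₀) (g' • x₀) := by
  have hm := Nat.floor_le (by linarith : 0 ≤ 120 * D)
  have hm' := Nat.lt_floor_add_one (120 * D)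
  have h1 := (h _ hm).1
  have h2 := (h' _ hm).1
  have h3 := (h.dist_le hiso hf hσ hm).2
  set y := (β * f ^ (σ * (⌊120 * D⌋₊ : ℕ))) • x₀ with hy
  have h5 : dist x₀ y - 2 * η - η ≤ gromovProd x₀ (g • x₀) (g' • x₀) := by
    refine h4.le_of_le (y := y) ?_ ?_
    · rw [gromovProd, dist_comm y x₀] at h1
      rw [gromovProd, dist_comm (g • x₀) y]
      linarith
    · rw [gromovProd, dist_comm y x₀] at h2
      rw [gromovProd]
      linarith
  linarith

end Conflicts

section Core

variable {X : Type*} [MetricSpace X] {G : Type*} [Group G] [MulAction G X]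

open Finset in
open Classical in
/-- The number of points with two heavy directions following prescribed axes, at distances from `x₀`
in a fixed residue class modulo `Q`, is small compared to the size of `A`. -/
theorem FourPoint.card_mul_le_of_followsAxis {η : ℝ} (h4 : FourPoint X η) (hη : 0 < η)
    (hiso : ∀ (g : G) (x y : X), dist (g • x) (g • y) = dist x y) {f : G} {x₀ : X}
    (hf : ∀ n : ℤ, dist x₀ (f ^ n • x₀) = |(n : ℝ)|) {R : ℝ} (hR : 1 + 2 * (5 * η) + 2 * η < R)
    {L : ℕ}
    (hfin : {g : G | dist x₀ (g • x₀) < R ∧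
      dist ((f ^ L) • x₀) ((g * f ^ L) • x₀) < R}.Finite)
    {D : ℝ} (hD : 20 * η + 20 ≤ D) (hLD : L ≤ D) {K Q : ℕ} {β : Fin 2 → G}
    (hK : ∀ i, dist x₀ (β i • x₀) + 100 * D < K) (hQ : ∀ i, dist x₀ (β i • x₀) + 102 * D < Q)
    {σ : Fin 2 → ℤ} (hσ : ∀ i, σ i = 1 ∨ σ i = -1) {A B : Finset G} (hBA : B ⊆ A)
    {u : Fin 2 → G → G} {q N : ℕ}
    (ho : ∀ a ∈ B, ∀ i, gromovProd (a • x₀) x₀ (u i a • x₀) ≤ D + η)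
    (h01 : ∀ a ∈ B, gromovProd (a • x₀) (u 0 a • x₀) (u 1 a • x₀) ≤ D)
    (hu : ∀ a ∈ B, ∀ i, FollowsAxis f x₀ η D (β i) (σ i) (a⁻¹ * u i a))
    (hN : ∀ a ∈ B, ∀ i, N ≤ #{c ∈ A | FollowsAxis f x₀ η D (β i) (σ i) (a⁻¹ * c)})
    (hq : ∀ a ∈ B, ⌊dist x₀ (a • x₀)⌋₊ % Q = q) :
    N * #B ≤ (2 * (4 * (#hfin.toFinset * (K * K))) + 1) * (2 * #A) := by
  set t : Fin 2 → ℝ := fun i => dist x₀ (β i • x₀) + 100 * D with ht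
  set W : G → ℕ := fun a => ⌊dist x₀ (a • x₀)⌋₊ with hW
  have ht0 : ∀ i, D + 4 * η < t i := fun i => by
    have : 0 ≤ dist x₀ (β i • x₀) := dist_nonneg
    simp only [ht]; linarith
  have hWd : ∀ a b, W a = W b → |dist x₀ (a • x₀) - dist x₀ (b • x₀)| ≤ 1 := by
    intro a b h
    have h1 := Nat.floor_le (dist_nonneg (x := x₀) (y := a • x₀))
    have h2 := Nat.floor_le (dist_nonneg (x := x₀) (y := b • x₀))
    have h3 := Nat.lt_floor_add_one (dist x₀ (a • x₀))
    have h4 := Nat.lt_floor_add_one (dist x₀ (b • x₀))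
    simp only [hW] at h
    rw [h] at h1 h3
    rw [abs_le]; constructor <;> linarith
  have htr : ∀ a g h : G, gromovProd ((a * g) • x₀) (a • x₀) (h • x₀) =
      gromovProd (g • x₀) x₀ ((a⁻¹ * h) • x₀) := by
    intro a g h
    rw [← gromovProd_smul hiso a (g • x₀), ← mul_smul, ← mul_smul, mul_inv_cancel_left]
  have hback : ∀ a ∈ B, ∀ i z, t i - η ≤ gromovProd (a • x₀) z (u i a • x₀) →
      gromovProd (a • x₀) x₀ z ≤ D + 2 * η := by
    intro a ha i z hz
    have := h4.le_of_lt (y := z) (ho a ha i) (by linarith [ht0 i])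
    linarith
  let r : G → G → Prop := fun a b => W a = W b ∧ ∃ (z : X) (i j : Fin 2), t j ≤ t i ∧
    t i - η ≤ gromovProd (a • x₀) z (u i a • x₀) ∧ t j - η ≤ gromovProd (b • x₀) z (u j b • x₀)
  have hout : ∀ a ∈ B, #{b ∈ B | r a b} ≤ 4 * (#hfin.toFinset * (K * K)) := by
    intro a ha
    let T : Fin 2 × Fin 2 → Finset G := fun p => {b ∈ B | W a = W b ∧ ∃ z : X, t p.2 ≤ t p.1 ∧
      t p.1 - η ≤ gromovProd (a • x₀) z (u p.1 a • x₀) ∧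
      t p.2 - η ≤ gromovProd (b • x₀) z (u p.2 b • x₀)}
    have hTcard : ∀ p, #(T p) ≤ #hfin.toFinset * (K * K) := by
      rintro ⟨i, j⟩
      have key : ∀ b ∈ T (i, j), ∀ m : ℕ, 10 * D ≤ m → (m : ℝ) ≤ 90 * D →
          gromovProd ((b * (β j * f ^ (σ j * m))) • x₀) (a • x₀) (u i a • x₀) ≤ 5 * η ∧
          dist (a • x₀) ((b * (β j * f ^ (σ j * m))) • x₀) < K := by
        intro b hb m hm hm'
        obtain ⟨hbB, hab, z, hij, hz, hz'⟩ := Finset.mem_filter.1 hb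
        have hm1 : (m : ℝ) ≤ 120 * D := by linarith
        have h1 := (hu b hbB j).dist_le hiso hf (hσ j) hm1
        have h2 := (hu b hbB j m hm1).1
        rw [← htr] at h2
        rw [← hiso b, ← mul_smul] at h1
        have h3 := h4.gromovProd_le_of_common_direction hη hD
          (dist_nonneg (x := x₀) (y := β j • x₀)) hm hm' (hback b hbB j z hz') (hback a ha i z hz)
          (hWd b a hab.symm) hz' (by simp only [ht] at hz hij ⊢; linarith) h2 h1.1
          (by linarith [h1.2])
        exact ⟨h3.1, h3.2.trans_lt (hK j)⟩
      have hm0 := Nat.le_ceil (10 * D)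
      have hm1 := Nat.ceil_lt_add_one (by linarith : 0 ≤ 10 * D)
      rcases hσ j with h | h
      · refine h4.card_le_of_wpd hiso hR hfin (b := β j * f ^ (σ j * (⌈10 * D⌉₊ : ℕ)))
          (v := a • x₀) (w := u i a • x₀) (T (i, j)) (fun b hb => ?_) (fun b hb => ?_)
        · exact key b hb _ hm0 (by linarith)
        · have := key b hb (⌈10 * D⌉₊ + L) (by push_cast; linarith [(L.cast_nonneg : (0 : ℝ) ≤ L)])
            (by push_cast; linarith)
          have e : b * (β j * f ^ (σ j * ((⌈10 * D⌉₊ + L : ℕ) : ℤ))) =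
              b * (β j * f ^ (σ j * (⌈10 * D⌉₊ : ℕ))) * f ^ L := by
            rw [h, one_mul, one_mul, Nat.cast_add, zpow_add, zpow_natCast, zpow_natCast]
            simp only [mul_assoc]
          rwa [e] at this
      · refine h4.card_le_of_wpd hiso hR hfin (b := β j * f ^ (σ j * (⌈10 * D⌉₊ + L : ℕ)))
          (v := a • x₀) (w := u i a • x₀) (T (i, j)) (fun b hb => ?_) (fun b hb => ?_)
        · exact key b hb _ (by push_cast; linarith [(L.cast_nonneg : (0 : ℝ) ≤ L)])
            (by push_cast; linarith)
        · have := key b hb ⌈10 * D⌉₊ hm0 (by linarith)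
          have e : b * (β j * f ^ (σ j * (⌈10 * D⌉₊ : ℕ))) =
              b * (β j * f ^ (σ j * ((⌈10 * D⌉₊ + L : ℕ) : ℤ))) * f ^ L := by
            rw [← zpow_natCast f L, mul_assoc b, mul_assoc (β j), ← zpow_add, h]
            congr 3
            push_cast
            ring
          rwa [e] at this
    have hsub : ({b ∈ B | r a b} : Finset G) ⊆ Finset.univ.biUnion T := by
      intro b hb
      obtain ⟨hbB, hab, z, i, j, h⟩ := Finset.mem_filter.1 hb
      exact Finset.mem_biUnion.2 ⟨(i, j), Finset.mem_univ _,
        Finset.mem_filter.2 ⟨hbB, hab, z, h⟩⟩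
    refine (Finset.card_le_card hsub).trans ?_
    have := Finset.card_biUnion_le_card_mul Finset.univ T _ fun p _ => hTcard p
    simpa using this
  obtain ⟨I, hIB, hI, hcard⟩ := exists_independent_of_outdegree_le r
    (4 * (#hfin.toFinset * (K * K))) B (fun a ha => by convert hout a ha)
  have hmain : N * #I ≤ 2 * #A := by
    refine h4.card_mul_le (Λ := Q - 1) hη (fun a : G => a • x₀) x₀ A I (hIB.trans hBA)
      (fun i a => u i a • x₀) t W ht0 ?_ (fun a ha => ho a (hIB ha)) (fun a ha => h01 a (hIB ha))
      ?_ ?_ ?_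
    · intro i
      have := hQ i
      simp only [ht]
      linarith
    · intro a ha i
      refine (hN a (hIB ha) i).trans (Finset.card_le_card fun c hc => ?_)
      obtain ⟨hcA, hc⟩ := Finset.mem_filter.1 hc
      refine Finset.mem_filter.2 ⟨hcA, ?_⟩
      have := hc.le_gromovProd h4 hiso hf (hσ i) hη hD (hu a (hIB ha) i)
      rwa [← gromovProd_smul hiso a, ← mul_smul, ← mul_smul, mul_inv_cancel_left,
        mul_inv_cancel_left] at this
    · intro a ha b hb hab
      have h1 : W a + Q ≤ W b := by
        have h2 : W a ≡ W b [MOD Q] := (hq a (hIB ha)).trans (hq b (hIB hb)).symm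
        have h3 := Nat.le_of_dvd (Nat.sub_pos_of_lt hab) ((Nat.modEq_iff_dvd' hab.le).1 h2)
        omega
      have h1' : (W a : ℝ) + Q ≤ W b := by exact_mod_cast h1
      have h2 := Nat.floor_le (dist_nonneg (x := x₀) (y := b • x₀))
      have h3 := Nat.lt_floor_add_one (dist x₀ (a • x₀))
      simp only [hW] at h1'
      linarith
    · intro a ha b hb hab hne z _ i j hz hz'
      rcases le_total (t j) (t i) with h | h
      · exact hI a ha b hb hne ⟨hab, z • x₀, i, j, h, hz, hz'⟩
      · exact hI b hb a ha hne.symm ⟨hab.symm, z • x₀, j, i, h, hz', hz⟩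
  calc N * #B ≤ N * ((2 * (4 * (#hfin.toFinset * (K * K))) + 1) * #I) :=
        Nat.mul_le_mul_left _ hcard
    _ = (2 * (4 * (#hfin.toFinset * (K * K))) + 1) * (N * #I) := by ring
    _ ≤ _ := Nat.mul_le_mul_left _ hmain

end Core

theorem finite_setOf_wordNorm_le {G : Type*} [Group G] {S : Finset G}
    (hgen : Subgroup.closure (S : Set G) = ⊤) (E : ℝ) :
    {g : G | (wordNorm S g : ℝ) ≤ E}.Finite := by
  have hlists : ∀ n : ℕ, {g : G | ∃ l : List G, l.length ≤ n ∧
      (∀ x ∈ l, x ∈ S ∨ x⁻¹ ∈ S) ∧ l.prod = g}.Finite := by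
    intro n
    induction n with
    | zero =>
      refine (Set.finite_singleton (1 : G)).subset ?_
      rintro g ⟨l, hl, -, rfl⟩
      simp [List.length_eq_zero_iff.1 (Nat.le_zero.1 hl)]
    | succ n ih =>
      have hS : {x : G | x ∈ S ∨ x⁻¹ ∈ S}.Finite := by
        refine (S.finite_toSet.union S.finite_toSet.inv).subset fun x hx => ?_
        simpa using hx
      refine ((Set.finite_singleton (1 : G)).union (Set.Finite.image2 (· * ·) hS ih)).subset ?_
      rintro g ⟨_ | ⟨x, l⟩, hl, hl', rfl⟩
      · simp
      · refine Or.inr ⟨x, hl' x (by simp), l.prod, ⟨l, by simpa using hl, fun y hy =>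
          hl' y (by simp [hy]), rfl⟩, by simp⟩
  refine (hlists ⌊E⌋₊).subset fun g hg => ?_
  have hne : {n : ℕ | ∃ l : List G, l.length = n ∧ (∀ x ∈ l, x ∈ S ∨ x⁻¹ ∈ S) ∧
      l.prod = g}.Nonempty := by
    have hg' : g ∈ Submonoid.closure ((S : Set G) ∪ (S : Set G)⁻¹) := by
      rw [← Subgroup.closure_toSubmonoid, hgen]
      trivial
    obtain ⟨l, hl, rfl⟩ := Submonoid.exists_list_of_mem_closure hg'
    exact ⟨_, l, rfl, fun x hx => by simpa using hl x hx, rfl⟩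
  obtain ⟨l, hl, hl', hg'⟩ := Nat.sInf_mem hne
  exact ⟨l, hl.le.trans (Nat.le_floor hg), hl', hg'⟩

section Heavy

variable {X : Type*} [MetricSpace X] {G : Type*} [Group G] [MulAction G X]

/-- The points `a` from which two transverse directions, neither of them towards `x₀`, follow the
axes given by `k` and each contain at least `N` points of `A`. -/
def HasHeavyDirections (f : G) (x₀ : X) (η D : ℝ) (A : Finset G) (N : ℕ) (a : G)
    (k : Fin 2 → G × ℤ) (u : Fin 2 → G) : Prop :=
  (∀ i, gromovProd (a • x₀) x₀ (u i • x₀) ≤ D + η) ∧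
  gromovProd (a • x₀) (u 0 • x₀) (u 1 • x₀) ≤ D ∧
  (∀ i, FollowsAxis f x₀ η D (k i).1 (k i).2 (a⁻¹ * u i)) ∧
  ∀ i, N ≤ {c ∈ (A : Set G) | FollowsAxis f x₀ η D (k i).1 (k i).2 (a⁻¹ * c)}.ncard

/-- If no two directions cover most of `A` as seen from `a`, then there are two transverse heavy
directions that do not point towards `x₀`. -/
theorem FourPoint.exists_hasHeavyDirections {η : ℝ} (h4 : FourPoint X η) {f : G} {x₀ : X} {D : ℝ}
    {A : Finset G} {N : ℕ} {a : G} {T : Finset (G × ℤ)}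
    (h : ∀ u v : G, ∃ k ∈ T,
      N ≤ {c ∈ (A : Set G) | FollowsAxis f x₀ η D k.1 k.2 (a⁻¹ * c)}.ncard ∧
      ∃ c : G, FollowsAxis f x₀ η D k.1 k.2 (a⁻¹ * c) ∧
        gromovProd (a • x₀) (c • x₀) (u • x₀) ≤ D ∧ gromovProd (a • x₀) (c • x₀) (v • x₀) ≤ D) :
    ∃ k : Fin 2 → G × ℤ, (∀ i, k i ∈ T) ∧
      ∃ u : Fin 2 → G, HasHeavyDirections f x₀ η D A N a k u := by
  obtain ⟨k₁, hk₁, hN₁, c₁, hc₁, -⟩ := h 1 1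
  obtain ⟨k₂, hk₂, hN₂, c₂, hc₂, h21, -⟩ := h c₁ c₁
  obtain ⟨k₃, hk₃, hN₃, c₃, hc₃, h31, h32⟩ := h c₁ c₂
  have hroot : ∀ c c' : G, gromovProd (a • x₀) (c • x₀) (c' • x₀) ≤ D →
      gromovProd (a • x₀) x₀ (c • x₀) ≤ D + η ∨ gromovProd (a • x₀) x₀ (c' • x₀) ≤ D + η := by
    intro c c' hcc
    by_contra! hcon
    have := h4.le_of_lt (y := x₀) hcc hcon.2
    rw [gromovProd_comm] at this
    linarith [hcon.1]
  have hpair : ∀ (k k' : G × ℤ) (c c' : G), k ∈ T → k' ∈ T →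
      N ≤ {c ∈ (A : Set G) | FollowsAxis f x₀ η D k.1 k.2 (a⁻¹ * c)}.ncard →
      N ≤ {c ∈ (A : Set G) | FollowsAxis f x₀ η D k'.1 k'.2 (a⁻¹ * c)}.ncard →
      FollowsAxis f x₀ η D k.1 k.2 (a⁻¹ * c) → FollowsAxis f x₀ η D k'.1 k'.2 (a⁻¹ * c') →
      gromovProd (a • x₀) (c • x₀) (c' • x₀) ≤ D →
      gromovProd (a • x₀) x₀ (c • x₀) ≤ D + η → gromovProd (a • x₀) x₀ (c' • x₀) ≤ D + η →
      ∃ k : Fin 2 → G × ℤ, (∀ i, k i ∈ T) ∧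
        ∃ u : Fin 2 → G, HasHeavyDirections f x₀ η D A N a k u := by
    intro k k' c c' hk hk' hN hN' hc hc' hcc ho ho'
    exact ⟨![k, k'], Fin.forall_fin_two.2 ⟨hk, hk'⟩, ![c, c'], Fin.forall_fin_two.2 ⟨ho, ho'⟩, hcc,
      Fin.forall_fin_two.2 ⟨hc, hc'⟩, Fin.forall_fin_two.2 ⟨hN, hN'⟩⟩
  rcases hroot _ _ h21 with h2 | h1
  · rcases hroot _ _ h31 with h3 | h1
    · exact hpair _ _ _ _ hk₃ hk₂ hN₃ hN₂ hc₃ hc₂ h32 h3 h2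
    · exact hpair _ _ _ _ hk₂ hk₁ hN₂ hN₁ hc₂ hc₁ h21 h2 h1
  · rcases hroot _ _ h32 with h3 | h2
    · exact hpair _ _ _ _ hk₃ hk₁ hN₃ hN₁ hc₃ hc₁ h31 h3 h1
    · exact hpair _ _ _ _ hk₂ hk₁ hN₂ hN₁ hc₂ hc₁ h21 h2 h1

open Finset in
open Classical in
/-- The number of points with two heavy directions following finitely many given axes is small
compared to the size of `A`. -/
theorem FourPoint.card_hasHeavyDirections_le {η : ℝ} (h4 : FourPoint X η) (hη : 0 < η)
    (hiso : ∀ (g : G) (x y : X), dist (g • x) (g • y) = dist x y) {f : G} {x₀ : X}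
    (hf : ∀ n : ℤ, dist x₀ (f ^ n • x₀) = |(n : ℝ)|) {R : ℝ} (hR : 1 + 2 * (5 * η) + 2 * η < R)
    {L : ℕ}
    (hfin : {g : G | dist x₀ (g • x₀) < R ∧
      dist ((f ^ L) • x₀) ((g * f ^ L) • x₀) < R}.Finite)
    {D : ℝ} (hD : 20 * η + 20 ≤ D) (hLD : L ≤ D) (T : Finset (G × ℤ))
    (hT : ∀ k ∈ T, k.2 = 1 ∨ k.2 = -1) :
    ∃ C : ℕ, ∀ (A B : Finset G) (N : ℕ), B ⊆ A →
      (∀ a ∈ B, ∃ k : Fin 2 → G × ℤ, (∀ i, k i ∈ T) ∧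
        ∃ u : Fin 2 → G, HasHeavyDirections f x₀ η D A N a k u) →
      N * #B ≤ C * #A := by
  obtain ⟨K, hK⟩ : ∃ K : ℕ, ∀ k ∈ T, dist x₀ (k.1 • x₀) + 102 * D < K := by
    obtain ⟨b, hb⟩ := (T.image fun k => dist x₀ (k.1 • x₀) + 102 * D).bddAbove
    obtain ⟨K, hK⟩ := exists_nat_gt b
    exact ⟨K, fun k hk => (hb (Finset.mem_image_of_mem _ hk)).trans_lt hK⟩
  refine ⟨#(Fintype.piFinset (fun _ : Fin 2 => T) ×ˢ Finset.range K) *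
    ((2 * (4 * (#hfin.toFinset * (K * K))) + 1) * 2), fun A B N hBA hB => ?_⟩
  choose! k hkT u hku using hB
  let key : G → (Fin 2 → G × ℤ) × ℕ := fun a => (k a, ⌊dist x₀ (a • x₀)⌋₊ % K)
  have hmaps : ∀ a ∈ B, key a ∈ Fintype.piFinset (fun _ : Fin 2 => T) ×ˢ Finset.range K := by
    intro a ha
    refine Finset.mem_product.2 ⟨Fintype.mem_piFinset.2 (hkT a ha), Finset.mem_range.2 ?_⟩
    refine Nat.mod_lt _ ?_
    have h1 := hK _ (hkT a ha 0)
    have h2 : 0 ≤ dist x₀ ((k a 0).1 • x₀) := dist_nonneg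
    have : (0 : ℝ) < K := by linarith
    exact_mod_cast this
  have hfiber : ∀ p ∈ Fintype.piFinset (fun _ : Fin 2 => T) ×ˢ Finset.range K,
      N * #{a ∈ B | key a = p} ≤ (2 * (4 * (#hfin.toFinset * (K * K))) + 1) * (2 * #A) := by
    rintro ⟨p, q⟩ hp
    have hpT := Fintype.mem_piFinset.1 (Finset.mem_product.1 hp).1
    have hmem : ∀ a ∈ ({a ∈ B | key a = (p, q)} : Finset G), a ∈ B ∧ k a = p ∧
        ⌊dist x₀ (a • x₀)⌋₊ % K = q := by
      intro a ha
      simpa [key] using ha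
    refine h4.card_mul_le_of_followsAxis hη hiso hf hR hfin hD hLD (Q := K)
      (β := fun i => (p i).1) (σ := fun i => (p i).2) (u := fun i a => u a i) (q := q)
      (fun i => ?_) (fun i => hK _ (hpT i)) (fun i => hT _ (hpT i))
      ((Finset.filter_subset _ _).trans hBA) (fun a ha => ?_) (fun a ha => ?_) (fun a ha => ?_)
      (fun a ha => ?_) (fun a ha => (hmem a ha).2.2)
    · linarith [hK _ (hpT i)]
    · exact (hku a (hmem a ha).1).1
    · exact (hku a (hmem a ha).1).2.1
    · obtain ⟨haB, rfl, -⟩ := hmem a ha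
      exact (hku a haB).2.2.1
    · obtain ⟨haB, rfl, -⟩ := hmem a ha
      intro i
      have := (hku a haB).2.2.2 i
      refine this.trans_eq ?_
      rw [← Set.ncard_coe_finset]
      congr 1
      ext c
      simp
  calc N * #B = ∑ p ∈ Fintype.piFinset (fun _ : Fin 2 => T) ×ˢ Finset.range K,
        N * #{a ∈ B | key a = p} := by
        rw [Finset.card_eq_sum_card_fiberwise hmaps, Finset.mul_sum]
    _ ≤ _ := Finset.sum_le_card_nsmul _ _ _ hfiber
    _ = _ := by rw [smul_eq_mul]; ring

end Heavy

/-- **Magic lemma for WPD actions** (Proposition 7.2 of the paper), with `f`-halfspaces. -/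
theorem magic_lemma_acylindrical
    {X : Type*} [MetricSpace X] {G : Type*} [Group G] [MulAction G X]
    (δ : ℝ) (hX : GromovHyperbolic X δ)
    (hiso : ∀ (g : G) (x y : X), dist (g • x) (g • y) = dist x y)
    (hnvc : ¬ VirtuallyCyclic G)
    (f : G) (ℓ : ℝ → X) (hgeo : ∀ s t : ℝ, dist (ℓ s) (ℓ t) = |s - t|)
    (haxis : ∀ t : ℝ, f • ℓ t = ℓ (t + 1))
    (x₀ : X) (hx₀ : x₀ ∈ Set.range ℓ) (hwpd : WPD f x₀)
    (S : Finset G) (hgen : Subgroup.closure (S : Set G) = ⊤) :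
    ∃ D₀ : ℝ, 0 < D₀ ∧ ∀ ε : ℝ, 0 < ε → ∀ D : ℝ, D₀ ≤ D →
      ∀ E E' : ℝ, 0 ≤ E → 0 ≤ E' → ∃ N : ℕ,
        ∀ A : Finset G, ∃ A' : Finset G, A' ⊆ A ∧ (1 - ε) * (A.card : ℝ) ≤ (A'.card : ℝ) ∧
          ∀ a ∈ A', ∃ u₁ u₂ : G,
            ((A : Set G) \
              a • ((fHalf S ℓ x₀ D E u₁ ∪ fHalf S ℓ x₀ D E u₂) \
                {g : G | (wordNorm S g : ℝ) ≤ E'})).ncard ≤ N := by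
  classical
  have hδ : 0 ≤ δ := hX.nonneg x₀
  obtain ⟨η, hηδ⟩ : ∃ η, η = 3 * δ + 1 := ⟨_, rfl⟩
  have hη : 0 < η := by linarith
  have h4 : FourPoint X η := hηδ ▸ hX.fourPoint
  have hf : ∀ n : ℤ, dist x₀ (f ^ n • x₀) = |(n : ℝ)| := by
    obtain ⟨τ, rfl⟩ := hx₀
    intro n
    rw [zpow_smul_axis haxis, hgeo, sub_add_cancel_left, abs_neg]
  obtain ⟨L, -, hfin⟩ := hwpd (2 + 12 * η) (by linarith)
  refine ⟨20 * η + 20 + L, by positivity, fun ε hε D hD E E' _ _ => ?_⟩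
  have hL0 : (0 : ℝ) ≤ L := L.cast_nonneg
  have hB := finite_setOf_wordNorm_le hgen E
  have hB' := finite_setOf_wordNorm_le hgen E'
  obtain ⟨n₀, hn₀⟩ : ∃ n₀ : ℕ, ∀ h ∈ hB.toFinset, 2 * dist x₀ (h • x₀) + 4 * η + 1 ≤ n₀ := by
    obtain ⟨b, hb⟩ := (hB.toFinset.image fun h => 2 * dist x₀ (h • x₀) + 4 * η + 1).bddAbove
    obtain ⟨n₀, hn₀⟩ := exists_nat_ge b
    exact ⟨n₀, fun h hh => (hb (Finset.mem_image_of_mem _ hh)).trans hn₀⟩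
  let T : Finset (G × ℤ) := (hB.toFinset ×ˢ Finset.Icc (-n₀ : ℤ) n₀ ×ˢ ({1, -1} : Finset ℤ)).image
    fun p => (p.1 * f ^ p.2.1, p.2.2)
  have hT : ∀ k ∈ T, k.2 = 1 ∨ k.2 = -1 := by
    intro k hk
    obtain ⟨p, hp, rfl⟩ := Finset.mem_image.1 hk
    simpa using (Finset.mem_product.1 (Finset.mem_product.1 hp).2).2
  have hfollow : ∀ g : G, (∃ h : G, (wordNorm S h : ℝ) ≤ E ∧
      250 * D ≤ projDist (h • Set.range ℓ) {x₀} {g • x₀}) →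
      ∃ k ∈ T, FollowsAxis f x₀ η D k.1 k.2 g := by
    rintro g ⟨h, hh, hproj⟩
    obtain ⟨n, hn, σ, hσ, hg⟩ := exists_followsAxis hX h4 hη (by linarith) hiso hgeo haxis hx₀
      (by linarith) hproj
    have hhB : h ∈ hB.toFinset := hB.mem_toFinset.2 hh
    have hn' : |n| ≤ (n₀ : ℤ) := by exact_mod_cast hn.trans (hn₀ h hhB)
    exact ⟨(h * f ^ n, σ), Finset.mem_image.2 ⟨(h, n, σ), Finset.mem_product.2 ⟨hhB,
      Finset.mem_product.2 ⟨Finset.mem_Icc.2 (abs_le.1 hn'), by simpa using hσ⟩⟩, rfl⟩, hg⟩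
  obtain ⟨C, hC⟩ := h4.card_hasHeavyDirections_le hη hiso hf (R := 2 + 12 * η) (by linarith) hfin
    (D := D) (by linarith) (by linarith) T hT
  obtain ⟨M, hM⟩ := exists_nat_gt (C / ε)
  have hM0 : (0 : ℝ) < M := lt_of_le_of_lt (by positivity) hM
  refine ⟨hB'.toFinset.card + T.card * M, fun A => ?_⟩
  let good : G → Prop := fun a => ∃ u₁ u₂ : G,
    ((A : Set G) \ a • ((fHalf S ℓ x₀ D E u₁ ∪ fHalf S ℓ x₀ D E u₂) \
      {g : G | (wordNorm S g : ℝ) ≤ E'})).ncard ≤ hB'.toFinset.card + T.card * M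
  refine ⟨A.filter good, Finset.filter_subset _ _, ?_, fun a ha => (Finset.mem_filter.1 ha).2⟩
  have hbad : M * (A.filter fun a => ¬ good a).card ≤ C * A.card := by
    refine hC A _ M (Finset.filter_subset _ _) fun a ha => h4.exists_hasHeavyDirections
      fun u v => ?_
    have hna := (Finset.mem_filter.1 ha).2
    by_contra! hcon
    refine hna ⟨a⁻¹ * u, a⁻¹ * v, ?_⟩
    let F : G × ℤ → Finset G := fun k => A.filter fun c =>
      FollowsAxis f x₀ η D k.1 k.2 (a⁻¹ * c) ∧
        gromovProd (a • x₀) (c • x₀) (u • x₀) ≤ D ∧ gromovProd (a • x₀) (c • x₀) (v • x₀) ≤ D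
    have hF : ∀ k ∈ T, (F k).card ≤ M := by
      intro k hk
      by_contra! hlt
      obtain ⟨c, hc⟩ := Finset.card_pos.1 (hlt.trans_le' M.zero_le)
      obtain ⟨-, hc₁, hcu, hcv⟩ := Finset.mem_filter.1 hc
      refine (hcon k hk ?_ c hc₁ hcu).not_ge hcv
      refine hlt.le.trans ?_
      rw [← Set.ncard_coe_finset]
      refine Set.ncard_le_ncard (fun c hc => ?_) (A.finite_toSet.subset fun c hc => hc.1)
      have := Finset.mem_filter.1 hc
      exact ⟨this.1, this.2.1⟩
    have hgp : ∀ c w : G, gromovProd x₀ ((a⁻¹ * c) • x₀) ((a⁻¹ * w) • x₀) =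
        gromovProd (a • x₀) (c • x₀) (w • x₀) := by
      intro c w
      rw [← gromovProd_smul hiso a]
      simp [smul_smul]
    have hsub : ((A : Set G) \ a • ((fHalf S ℓ x₀ D E (a⁻¹ * u) ∪ fHalf S ℓ x₀ D E (a⁻¹ * v)) \
        {g : G | (wordNorm S g : ℝ) ≤ E'})) ⊆
        ((hB'.toFinset.image (a * ·) ∪ T.biUnion F : Finset G) : Set G) := by
      rintro c ⟨hcA, hc⟩
      rw [Set.mem_smul_set_iff_inv_smul_mem, smul_eq_mul] at hc
      by_cases hcE : (wordNorm S (a⁻¹ * c) : ℝ) ≤ E'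
      · exact Finset.mem_union_left _ (Finset.mem_image.2
          ⟨a⁻¹ * c, hB'.mem_toFinset.2 hcE, mul_inv_cancel_left a c⟩)
      · have hu : a⁻¹ * c ∉ fHalf S ℓ x₀ D E (a⁻¹ * u) := fun h => hc ⟨Or.inl h, hcE⟩
        have hv : a⁻¹ * c ∉ fHalf S ℓ x₀ D E (a⁻¹ * v) := fun h => hc ⟨Or.inr h, hcE⟩
        rw [fHalf, Set.mem_ofPred_eq, not_or, not_not, not_lt, hgp] at hu hv
        obtain ⟨k, hk, hkc⟩ := hfollow _ hu.2
        exact Finset.mem_union_right _ (Finset.mem_biUnion.2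
          ⟨k, hk, Finset.mem_filter.2 ⟨hcA, hkc, hu.1, hv.1⟩⟩)
    refine (Set.ncard_le_ncard hsub (Finset.finite_toSet _)).trans ?_
    rw [Set.ncard_coe_finset]
    exact (Finset.card_union_le _ _).trans
      (add_le_add Finset.card_image_le (Finset.card_biUnion_le_card_mul _ _ _ hF))
  have hsum := Finset.card_filter_add_card_filter_not (s := A) good
  have hbadR : (M : ℝ) * (A.filter fun a => ¬ good a).card ≤ M * (ε * A.card) := by
    refine (by exact_mod_cast hbad : (M : ℝ) * _ ≤ C * A.card).trans ?_
    rw [← mul_assoc]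
    exact mul_le_mul_of_nonneg_right ((div_lt_iff₀ hε).1 hM).le (Nat.cast_nonneg _)
  have hle := le_of_mul_le_mul_left hbadR hM0
  have hsumR : ((A.filter good).card : ℝ) + (A.filter fun a => ¬ good a).card = A.card := by
    exact_mod_cast hsum
  linarith
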